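/- Suppose d ≤ 2. Then for any c ∈ ℭ_+ and any P ∈ 𝔓_+ there exists Q ∈ 𝔓_+ such that dμ = (P/Q) dm satisfies c_k = ∫_{𝕋^d} e^{i(k,θ)} (P/Q) dm for all k ∈ Λ. Moreover, this Q is the unique solution of the strictly convex problem of minimizing the dual functional J_P over Q ∈ 𝔓_+. -/

import Mathlib

open MeasureTheory Complex Set

noncomputable section

namespace RCE

/-- The scalar product (k,θ) = Σⱼ kⱼ θⱼ. -/
def dotP (d : ℕ) (k : Fin d → ℤ) (θ : Fin d → ℝ) : ℝ := ∑ j, (k j : ℝ) * θ j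

/-- The d-dimensional torus 𝕋^d = (−π,π]^d. -/
def Td (d : ℕ) : Set (Fin d → ℝ) := Set.univ.pi fun _ => Set.Ioc (-Real.pi) Real.pi

/-- Normalized Lebesgue measure dm = (2π)^{-d} dθ on 𝕋^d. -/
def dm (d : ℕ) : Measure (Fin d → ℝ) :=
  (ENNReal.ofReal ((2 * Real.pi) ^ d))⁻¹ • (volume.restrict (Td d))

/-- Conjugate-symmetric coefficient sequences supported on Λ. -/
def IsCoeff (d : ℕ) (Λ : Finset (Fin d → ℤ)) (p : (Fin d → ℤ) → ℂ) : Prop :=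
  (∀ k, k ∉ Λ → p k = 0) ∧ ∀ k, p (-k) = starRingEnd ℂ (p k)

/-- Evaluation of the (real-valued) trigonometric polynomial
`P(e^{iθ}) = Σ_{k∈Λ} p_k e^{-i(k,θ)}`. -/
def eval (d : ℕ) (Λ : Finset (Fin d → ℤ)) (p : (Fin d → ℤ) → ℂ) (θ : Fin d → ℝ) : ℝ :=
  (∑ k ∈ Λ, p k * Complex.exp (-(dotP d k θ : ℂ) * Complex.I)).re

/-- `𝔓̄₊` : the closed cone of nonnegative trigonometric polynomials. -/
def Pbar (d : ℕ) (Λ : Finset (Fin d → ℤ)) : Set ((Fin d → ℤ) → ℂ) :=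
  {p | IsCoeff d Λ p ∧ ∀ θ ∈ Td d, 0 ≤ eval d Λ p θ}

/-- `𝔓₊` : the open cone of positive trigonometric polynomials. -/
def Pplus (d : ℕ) (Λ : Finset (Fin d → ℤ)) : Set ((Fin d → ℤ) → ℂ) :=
  {p | IsCoeff d Λ p ∧ ∀ θ ∈ Td d, 0 < eval d Λ p θ}

/-- The pairing ⟨c,p⟩ = Σ_{k∈Λ} c_k conj(p_k) (real-valued by conjugate symmetry). -/
def pair (d : ℕ) (Λ : Finset (Fin d → ℤ)) (c p : (Fin d → ℤ) → ℂ) : ℝ :=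
  (∑ k ∈ Λ, c k * starRingEnd ℂ (p k)).re

/-- `ℭ₊` : the interior of the dual cone. -/
def Cplus (d : ℕ) (Λ : Finset (Fin d → ℤ)) : Set ((Fin d → ℤ) → ℂ) :=
  {c | IsCoeff d Λ c ∧ ∀ p ∈ Pbar d Λ, p ≠ 0 → 0 < pair d Λ c p}

/-- `ℭ̄₊` : the closed dual cone. -/
def Cbar (d : ℕ) (Λ : Finset (Fin d → ℤ)) : Set ((Fin d → ℤ) → ℂ) :=
  {c | IsCoeff d Λ c ∧ ∀ p ∈ Pbar d Λ, 0 ≤ pair d Λ c p}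

/-- The dual functional J_P(Q) = ⟨c,q⟩ − ∫ P log Q dm. -/
def J (d : ℕ) (Λ : Finset (Fin d → ℤ)) (c P Q : (Fin d → ℤ) → ℂ) : ℝ :=
  pair d Λ c Q - ∫ θ, eval d Λ P θ * Real.log (eval d Λ Q θ) ∂(dm d)

/-- Covariance matching for an absolutely continuous measure Φ dm:
`c_k = ∫ e^{i(k,θ)} Φ(θ) dm(θ)` for all k ∈ Λ. -/
def Matches (d : ℕ) (Λ : Finset (Fin d → ℤ)) (c : (Fin d → ℤ) → ℂ)
    (Φ : (Fin d → ℝ) → ℝ) : Prop :=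
  ∀ k ∈ Λ, c k = ∫ θ, Complex.exp ((dotP d k θ : ℂ) * Complex.I) * (Φ θ : ℂ) ∂(dm d)

/-- The ℓ¹ norm of the coefficients with index in `Λ`. -/
def coeffNorm (d : ℕ) (Λ : Finset (Fin d → ℤ)) (q : (Fin d → ℤ) → ℂ) : ℝ := ∑ k ∈ Λ, ‖q k‖

/-- The coefficients of the constant polynomial `1`. -/
def oneCoeff (d : ℕ) : (Fin d → ℤ) → ℂ := Pi.single 0 1

section

variable {d : ℕ} {Λ : Finset (Fin d → ℤ)}

lemma norm_exp_dotP (k : Fin d → ℤ) (θ : Fin d → ℝ) :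
    ‖Complex.exp (-(dotP d k θ : ℂ) * Complex.I)‖ = 1 := by
  have := Complex.norm_exp_ofReal_mul_I (-dotP d k θ)
  simpa using this

lemma continuous_dotP (k : Fin d → ℤ) : Continuous (dotP d k) := by
  unfold dotP; fun_prop

lemma continuous_eval_uncurry :
    Continuous fun x : ((Fin d → ℤ) → ℂ) × (Fin d → ℝ) => eval d Λ x.1 x.2 := by
  have h := fun k => continuous_dotP (d := d) k
  unfold eval
  fun_prop

lemma continuous_eval (q : (Fin d → ℤ) → ℂ) : Continuous (eval d Λ q) :=
  continuous_eval_uncurry.comp (Continuous.prodMk_right q)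

lemma continuous_eval_left (θ : Fin d → ℝ) : Continuous fun q => eval d Λ q θ :=
  continuous_eval_uncurry.comp (Continuous.prodMk_left θ)

lemma continuous_coeffNorm : Continuous (coeffNorm d Λ) := by
  unfold coeffNorm; fun_prop

lemma continuous_pair (c : (Fin d → ℤ) → ℂ) : Continuous (pair d Λ c) := by
  unfold pair; fun_prop

lemma eval_add (p q : (Fin d → ℤ) → ℂ) (θ : Fin d → ℝ) :
    eval d Λ (p + q) θ = eval d Λ p θ + eval d Λ q θ := by
  simp only [eval, Pi.add_apply, add_mul, Finset.sum_add_distrib, Complex.add_re]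

lemma eval_smul (a : ℝ) (q : (Fin d → ℤ) → ℂ) (θ : Fin d → ℝ) :
    eval d Λ (a • q) θ = a * eval d Λ q θ := by
  simp only [eval, Pi.smul_apply, Complex.real_smul, mul_assoc, ← Finset.mul_sum,
    Complex.re_ofReal_mul]

lemma pair_add (c p q : (Fin d → ℤ) → ℂ) :
    pair d Λ c (p + q) = pair d Λ c p + pair d Λ c q := by
  simp only [pair, Pi.add_apply, map_add, mul_add, Finset.sum_add_distrib, Complex.add_re]

lemma pair_smul (c : (Fin d → ℤ) → ℂ) (a : ℝ) (q : (Fin d → ℤ) → ℂ) :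
    pair d Λ c (a • q) = a * pair d Λ c q := by
  simp only [pair, Pi.smul_apply, Complex.real_smul, map_mul, Complex.conj_ofReal,
    mul_left_comm _ (a : ℂ), ← Finset.mul_sum, Complex.re_ofReal_mul]

lemma coeffNorm_smul (a : ℝ) (q : (Fin d → ℤ) → ℂ) :
    coeffNorm d Λ (a • q) = |a| * coeffNorm d Λ q := by
  simp [coeffNorm, Finset.mul_sum]

lemma coeffNorm_nonneg (q : (Fin d → ℤ) → ℂ) : 0 ≤ coeffNorm d Λ q :=
  Finset.sum_nonneg fun _ _ => norm_nonneg _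

lemma abs_eval_le (q : (Fin d → ℤ) → ℂ) (θ : Fin d → ℝ) :
    |eval d Λ q θ| ≤ coeffNorm d Λ q := by
  refine (Complex.abs_re_le_norm _).trans ((norm_sum_le _ _).trans ?_)
  simp [norm_exp_dotP, coeffNorm, -neg_mul]

lemma IsCoeff.add {p q : (Fin d → ℤ) → ℂ} (hp : IsCoeff d Λ p) (hq : IsCoeff d Λ q) :
    IsCoeff d Λ (p + q) :=
  ⟨fun k hk => by simp [hp.1 k hk, hq.1 k hk], fun k => by simp [hp.2 k, hq.2 k]⟩

lemma IsCoeff.smul {q : (Fin d → ℤ) → ℂ} (hq : IsCoeff d Λ q) (a : ℝ) :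
    IsCoeff d Λ (a • q) :=
  ⟨fun k hk => by simp [hq.1 k hk], fun k => by simp [hq.2 k]⟩

lemma isCoeff_oneCoeff (h0 : (0 : Fin d → ℤ) ∈ Λ) : IsCoeff d Λ (oneCoeff d) := by
  refine ⟨fun k hk => ?_, fun k => ?_⟩
  · have : k ≠ 0 := fun h => hk (h ▸ h0)
    simp [oneCoeff, this]
  · by_cases hk : k = 0
    · simp [oneCoeff, hk]
    · simp [oneCoeff, hk]

lemma eval_oneCoeff (h0 : (0 : Fin d → ℤ) ∈ Λ) (θ : Fin d → ℝ) :
    eval d Λ (oneCoeff d) θ = 1 := by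
  unfold eval
  rw [Finset.sum_eq_single 0]
  · simp [oneCoeff, dotP]
  · intro k _ hk; simp [oneCoeff, hk]
  · exact fun h => absurd h0 h

lemma coeffNorm_oneCoeff (h0 : (0 : Fin d → ℤ) ∈ Λ) : coeffNorm d Λ (oneCoeff d) = 1 := by
  unfold coeffNorm
  rw [Finset.sum_eq_single 0]
  · simp [oneCoeff]
  · intro k _ hk; simp [oneCoeff, hk]
  · exact fun h => absurd h0 h

lemma isClosed_isCoeff : IsClosed {q | IsCoeff d Λ q} := by
  simp only [IsCoeff, ofPred_and, ofPred_forall]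
  refine IsClosed.inter ?_ ?_
  · exact isClosed_iInter fun k => isClosed_iInter fun _ =>
      isClosed_eq (continuous_apply k) continuous_const
  · exact isClosed_iInter fun k => isClosed_eq (continuous_apply (-k))
      (Complex.continuous_conj.comp (continuous_apply k))

/-- A closed set of coefficients with bounded ℓ¹ norm is compact. -/
lemma isCompact_of_coeffNorm_le {s : Set ((Fin d → ℤ) → ℂ)} (hs : IsClosed s) (R : ℝ)
    (hR : ∀ q ∈ s, IsCoeff d Λ q ∧ coeffNorm d Λ q ≤ R) : IsCompact s := by
  refine IsCompact.of_isClosed_subset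
    (isCompact_univ_pi fun _ : Fin d → ℤ => isCompact_closedBall (0 : ℂ) R) hs ?_
  intro q hq k _
  obtain ⟨hq1, hq2⟩ := hR q hq
  rw [mem_closedBall_zero_iff]
  by_cases hk : k ∈ Λ
  · exact (Finset.single_le_sum (f := fun k => ‖q k‖) (fun _ _ => norm_nonneg _) hk).trans hq2
  · rw [hq1.1 k hk, norm_zero]
    exact (coeffNorm_nonneg q).trans hq2

lemma exists_mem_Td_eval_eq (θ : Fin d → ℝ) :
    ∃ θ' ∈ Td d, ∀ q, eval d Λ q θ = eval d Λ q θ' := by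
  have hπ := Real.two_pi_pos
  refine ⟨fun j => toIocMod hπ (-Real.pi) (θ j), fun j _ => ?_, fun q => ?_⟩
  · have := toIocMod_mem_Ioc hπ (-Real.pi) (θ j)
    rwa [show -Real.pi + 2 * Real.pi = Real.pi by ring] at this
  · unfold eval
    congr 1
    refine Finset.sum_congr rfl fun k _ => ?_
    congr 1
    rw [Complex.exp_eq_exp_iff_exists_int]
    refine ⟨-∑ j, k j * toIocDiv hπ (-Real.pi) (θ j), ?_⟩
    have : dotP d k θ = dotP d k (fun j => toIocMod hπ (-Real.pi) (θ j)) +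
        (2 * Real.pi) * ∑ j, (k j : ℝ) * toIocDiv hπ (-Real.pi) (θ j) := by
      rw [dotP, dotP, Finset.mul_sum, ← Finset.sum_add_distrib]
      refine Finset.sum_congr rfl fun j _ => ?_
      rw [toIocMod, zsmul_eq_mul]
      ring
    rw [this]
    push_cast
    ring

lemma eval_pos_of_mem_Pplus {q : (Fin d → ℤ) → ℂ} (hq : q ∈ Pplus d Λ) (θ : Fin d → ℝ) :
    0 < eval d Λ q θ := by
  obtain ⟨θ', h, e⟩ := exists_mem_Td_eval_eq (Λ := Λ) θ
  exact e q ▸ hq.2 θ' h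

/-- The closed box containing the torus is compact. -/
lemma isCompact_box : IsCompact (Set.univ.pi fun _ : Fin d => Icc (-Real.pi) Real.pi) :=
  isCompact_univ_pi fun _ => isCompact_Icc

lemma Td_subset_box : Td d ⊆ Set.univ.pi fun _ : Fin d => Icc (-Real.pi) Real.pi :=
  Set.pi_mono fun _ _ => Ioc_subset_Icc_self

lemma exists_eval_min (q : (Fin d → ℤ) → ℂ) :
    ∃ θ₀ ∈ Set.univ.pi fun _ : Fin d => Icc (-Real.pi) Real.pi,
      ∀ θ, eval d Λ q θ₀ ≤ eval d Λ q θ := by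
  obtain ⟨θ₀, h, hmin⟩ := (isCompact_box (d := d)).exists_isMinOn
    ⟨0, fun j _ => ⟨by simpa using Real.pi_pos.le, Real.pi_pos.le⟩⟩
    (continuous_eval (Λ := Λ) q).continuousOn
  refine ⟨θ₀, h, fun θ => ?_⟩
  obtain ⟨θ', h', e⟩ := exists_mem_Td_eval_eq (Λ := Λ) θ
  rw [e q]
  exact hmin (Td_subset_box h')

lemma exists_pos_le_eval_of_mem_Pplus {q : (Fin d → ℤ) → ℂ} (hq : q ∈ Pplus d Λ) :
    ∃ ε > 0, ∀ θ, ε ≤ eval d Λ q θ := by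
  obtain ⟨θ₀, -, h⟩ := exists_eval_min (Λ := Λ) q
  exact ⟨_, eval_pos_of_mem_Pplus hq θ₀, h⟩

lemma volume_Td : volume (Td d) = ENNReal.ofReal ((2 * Real.pi) ^ d) := by
  rw [Td, volume_pi_pi]
  simp only [Real.volume_Ioc, Finset.prod_const, Finset.card_univ, Fintype.card_fin]
  rw [ENNReal.ofReal_pow Real.two_pi_pos.le]
  ring_nf

instance isProbabilityMeasure_dm : IsProbabilityMeasure (dm d) where
  measure_univ := by
    have h : 0 < (2 * Real.pi) ^ d := pow_pos Real.two_pi_pos d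
    rw [dm, Measure.smul_apply, Measure.restrict_apply_univ, volume_Td, smul_eq_mul]
    exact ENNReal.inv_mul_cancel (by simpa using h) ENNReal.ofReal_ne_top

lemma integrable_dm {E : Type*} [NormedAddCommGroup E] {f : (Fin d → ℝ) → E}
    (hf : Continuous f) : Integrable f (dm d) := by
  have h : 0 < (2 * Real.pi) ^ d := pow_pos Real.two_pi_pos d
  refine Integrable.smul_measure ?_ (by simpa using h)
  exact (hf.continuousOn.integrableOn_compact isCompact_box).mono_set Td_subset_box

lemma continuous_mul_log_eval (P : (Fin d → ℤ) → ℂ) {Q : (Fin d → ℤ) → ℂ}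
    (hQ : ∀ θ, 0 < eval d Λ Q θ) :
    Continuous fun θ => eval d Λ P θ * Real.log (eval d Λ Q θ) :=
  (continuous_eval P).mul ((continuous_eval Q).log fun θ => (hQ θ).ne')

lemma dotP_neg (k : Fin d → ℤ) (θ : Fin d → ℝ) : dotP d (-k) θ = -dotP d k θ := by
  simp [dotP]

lemma dotP_sub (k l : Fin d → ℤ) (θ : Fin d → ℝ) :
    dotP d (k - l) θ = dotP d k θ - dotP d l θ := by
  simp [dotP, sub_mul]

lemma continuous_exp_dotP (k : Fin d → ℤ) :
    Continuous fun θ => Complex.exp ((dotP d k θ : ℂ) * Complex.I) := by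
  have h := continuous_dotP (d := d) k
  fun_prop

lemma integral_exp_int_mul_eq_zero {n : ℤ} (hn : n ≠ 0) :
    ∫ x in Ioc (-Real.pi) Real.pi, Complex.exp ((n : ℂ) * x * Complex.I) = 0 := by
  have hc : (n : ℂ) * Complex.I ≠ 0 := mul_ne_zero (by exact_mod_cast hn) Complex.I_ne_zero
  rw [← intervalIntegral.integral_of_le (by linarith [Real.pi_pos])]
  simp_rw [mul_right_comm _ _ Complex.I]
  rw [integral_exp_mul_complex hc, div_eq_zero_iff]
  left
  rw [sub_eq_zero, Complex.exp_eq_exp_iff_exists_int]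
  exact ⟨n, by push_cast; ring⟩

lemma integral_exp_dotP {k : Fin d → ℤ} (hk : k ≠ 0) :
    ∫ θ, Complex.exp ((dotP d k θ : ℂ) * Complex.I) ∂(dm d) = 0 := by
  obtain ⟨j, hj⟩ := Function.ne_iff.mp hk
  have h : ∀ θ : Fin d → ℝ, Complex.exp ((dotP d k θ : ℂ) * Complex.I) =
      ∏ j, Complex.exp ((k j : ℂ) * θ j * Complex.I) := fun θ => by
    rw [← Complex.exp_sum, dotP]
    push_cast
    rw [Finset.sum_mul]
  simp_rw [h]
  rw [dm, integral_smul_measure, Td, volume_pi, Measure.restrict_pi_pi,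
    integral_fintype_prod_eq_prod (fun j x => Complex.exp ((k j : ℂ) * (x : ℝ) * Complex.I)),
    Finset.prod_eq_zero (Finset.mem_univ j) (integral_exp_int_mul_eq_zero hj), smul_zero]

lemma ofReal_eval (hΛ : ∀ k ∈ Λ, -k ∈ Λ) {q : (Fin d → ℤ) → ℂ} (hq : IsCoeff d Λ q)
    (θ : Fin d → ℝ) :
    (eval d Λ q θ : ℂ) = ∑ k ∈ Λ, q k * Complex.exp (-(dotP d k θ : ℂ) * Complex.I) := by
  refine Complex.conj_eq_iff_re.mp ?_
  rw [map_sum]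
  refine Finset.sum_nbij' (fun k => -k) (fun k => -k) hΛ hΛ (by simp) (by simp) fun k _ => ?_
  rw [hq.2, dotP_neg, map_mul, ← Complex.exp_conj]
  simp

/-- The coefficients of a trigonometric polynomial are its moments. -/
lemma integral_exp_mul_eval (hΛ : ∀ k ∈ Λ, -k ∈ Λ) {q : (Fin d → ℤ) → ℂ}
    (hq : IsCoeff d Λ q) {j : Fin d → ℤ} (hj : j ∈ Λ) :
    ∫ θ, Complex.exp ((dotP d j θ : ℂ) * Complex.I) * (eval d Λ q θ : ℂ) ∂(dm d) = q j := by
  have h : ∀ θ, Complex.exp ((dotP d j θ : ℂ) * Complex.I) * (eval d Λ q θ : ℂ) =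
      ∑ k ∈ Λ, q k * Complex.exp ((dotP d (j - k) θ : ℂ) * Complex.I) := fun θ => by
    rw [ofReal_eval hΛ hq, Finset.mul_sum]
    refine Finset.sum_congr rfl fun k _ => ?_
    rw [mul_left_comm, ← Complex.exp_add, dotP_sub]
    push_cast
    ring_nf
  simp_rw [h]
  rw [integral_finsetSum _ fun k _ => (integrable_dm (continuous_exp_dotP _)).const_mul _,
    Finset.sum_eq_single j]
  · simp [dotP]
  · intro k _ hk
    rw [integral_const_mul, integral_exp_dotP (sub_ne_zero.mpr hk.symm), mul_zero]
  · exact fun h => absurd hj h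

lemma eq_of_eval_ae_eq (hΛ : ∀ k ∈ Λ, -k ∈ Λ) {p q : (Fin d → ℤ) → ℂ}
    (hp : IsCoeff d Λ p) (hq : IsCoeff d Λ q)
    (h : ∀ᵐ θ ∂(dm d), eval d Λ p θ = eval d Λ q θ) : p = q := by
  funext k
  by_cases hk : k ∈ Λ
  · rw [← integral_exp_mul_eval hΛ hp hk, ← integral_exp_mul_eval hΛ hq hk]
    refine integral_congr_ae ?_
    filter_upwards [h] with θ hθ
    rw [hθ]
  · rw [hp.1 k hk, hq.1 k hk]

/-- Pairing the moments of `Φ` with `h` integrates `Φ` against the polynomial of `h`. -/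
lemma pair_moments {Φ : (Fin d → ℝ) → ℝ} (hΦ : Continuous Φ) (c h : (Fin d → ℤ) → ℂ)
    (hc : ∀ k ∈ Λ, c k = ∫ θ, Complex.exp ((dotP d k θ : ℂ) * Complex.I) * (Φ θ : ℂ) ∂(dm d)) :
    pair d Λ c h = ∫ θ, Φ θ * eval d Λ h θ ∂(dm d) := by
  have hcont : ∀ k, Continuous fun θ =>
      Complex.exp ((dotP d k θ : ℂ) * Complex.I) * (Φ θ : ℂ) := fun k =>
    (continuous_exp_dotP k).mul (Complex.continuous_ofReal.comp hΦ)
  have e : ∑ k ∈ Λ, c k * starRingEnd ℂ (h k) = ∫ θ, ∑ k ∈ Λ,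
      Complex.exp ((dotP d k θ : ℂ) * Complex.I) * (Φ θ : ℂ) * starRingEnd ℂ (h k) ∂(dm d) := by
    rw [integral_finsetSum _ fun k _ => (integrable_dm (hcont k)).mul_const _]
    refine Finset.sum_congr rfl fun k hk => ?_
    rw [hc k hk, integral_mul_const]
  have hint : Integrable (fun θ => ∑ k ∈ Λ,
      Complex.exp ((dotP d k θ : ℂ) * Complex.I) * (Φ θ : ℂ) * starRingEnd ℂ (h k)) (dm d) :=
    integrable_finsetSum _ fun k _ => (integrable_dm (hcont k)).mul_const _
  have hre := (integral_re hint).symm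
  simp only [RCLike.re_to_complex] at hre
  rw [pair, e, hre]
  refine integral_congr_ae (ae_of_all _ fun θ => ?_)
  simp only [eval]
  rw [← Complex.re_ofReal_mul, Finset.mul_sum, Complex.re_sum, Complex.re_sum]
  refine Finset.sum_congr rfl fun k _ => ?_
  rw [← Complex.conj_re]
  congr 1
  simp only [map_mul, ← Complex.exp_conj, Complex.conj_ofReal, Complex.conj_I, Complex.conj_conj]
  ring_nf

lemma convex_Pplus : Convex ℝ (Pplus d Λ) := by
  intro p hp q hq a b ha hb hab
  refine ⟨(hp.1.smul a).add (hq.1.smul b), fun θ hθ => ?_⟩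
  rw [eval_add, eval_smul, eval_smul]
  have h1 := hp.2 θ hθ
  have h2 := hq.2 θ hθ
  rcases ha.eq_or_lt with rfl | ha
  · have : b = 1 := by linarith
    simpa [this] using h2
  · have := mul_pos ha h1
    have := mul_nonneg hb h2.le
    linarith

theorem strictConvexOn_J (hΛ : ∀ k ∈ Λ, -k ∈ Λ) (c : (Fin d → ℤ) → ℂ) {P : (Fin d → ℤ) → ℂ}
    (hP : P ∈ Pplus d Λ) : StrictConvexOn ℝ (Pplus d Λ) (J d Λ c P) := by
  refine ⟨convex_Pplus, fun p hp q hq hpq a b ha hb hab => ?_⟩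
  have hpq' := convex_Pplus hp hq ha.le hb.le hab
  have hP' := eval_pos_of_mem_Pplus hP
  have hp' := eval_pos_of_mem_Pplus hp
  have hq' := eval_pos_of_mem_Pplus hq
  have ip := integrable_dm (continuous_mul_log_eval P hp')
  have iq := integrable_dm (continuous_mul_log_eval P hq')
  have ipq := integrable_dm (continuous_mul_log_eval P (eval_pos_of_mem_Pplus hpq'))
  set g : (Fin d → ℝ) → ℝ := fun θ =>
    eval d Λ P θ * Real.log (eval d Λ (a • p + b • q) θ) -
      (a * (eval d Λ P θ * Real.log (eval d Λ p θ)) +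
        b * (eval d Λ P θ * Real.log (eval d Λ q θ))) with hg
  have hgeq : ∀ θ, g θ = eval d Λ P θ *
      (Real.log (a • eval d Λ p θ + b • eval d Λ q θ) -
        (a • Real.log (eval d Λ p θ) + b • Real.log (eval d Λ q θ))) := fun θ => by
    simp only [hg, eval_add, eval_smul, smul_eq_mul]
    ring
  have hg0 : 0 ≤ g := fun θ => by
    rw [hgeq]
    exact mul_nonneg (hP' θ).le
      (sub_nonneg.mpr (strictConcaveOn_log_Ioi.concaveOn.2 (hp' θ) (hq' θ) ha.le hb.le hab))
  have isum : Integrable (fun θ => a * (eval d Λ P θ * Real.log (eval d Λ p θ)) +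
      b * (eval d Λ P θ * Real.log (eval d Λ q θ))) (dm d) := (ip.const_mul a).add (iq.const_mul b)
  have hgi : Integrable g (dm d) := ipq.sub isum
  have hpos : 0 < ∫ θ, g θ ∂(dm d) := by
    refine lt_of_le_of_ne (integral_nonneg hg0) fun h => hpq ?_
    have hz := (integral_eq_zero_iff_of_nonneg hg0 hgi).mp h.symm
    refine eq_of_eval_ae_eq hΛ hp.1 hq.1 ?_
    filter_upwards [hz] with θ hθ
    by_contra hne
    have := mul_pos (hP' θ)
      (sub_pos.mpr (strictConcaveOn_log_Ioi.2 (hp' θ) (hq' θ) hne ha hb hab))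
    rw [← hgeq, hθ] at this
    exact lt_irrefl _ this
  have hsplit : ∫ θ, g θ ∂(dm d) =
      ∫ θ, eval d Λ P θ * Real.log (eval d Λ (a • p + b • q) θ) ∂(dm d) -
      (a * ∫ θ, eval d Λ P θ * Real.log (eval d Λ p θ) ∂(dm d) +
        b * ∫ θ, eval d Λ P θ * Real.log (eval d Λ q θ) ∂(dm d)) := by
    rw [integral_sub ipq isum, integral_add (ip.const_mul a) (iq.const_mul b),
      integral_const_mul, integral_const_mul]
  simp only [J, pair_add, pair_smul, smul_eq_mul]
  linarith

lemma J_add_smul_le {c P Q h : (Fin d → ℤ) → ℂ} (hP : ∀ θ, 0 ≤ eval d Λ P θ)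
    (hQ : ∀ θ, 0 < eval d Λ Q θ) {t : ℝ} (hQt : ∀ θ, 0 < eval d Λ (Q + t • h) θ) :
    J d Λ c P (Q + t • h) ≤ J d Λ c P Q + t * (pair d Λ c h -
      ∫ θ, eval d Λ P θ * eval d Λ h θ / eval d Λ (Q + t • h) θ ∂(dm d)) := by
  have i1 := integrable_dm (continuous_mul_log_eval P hQ)
  have i2 := integrable_dm (continuous_mul_log_eval P hQt)
  have i3 : Integrable (fun θ => eval d Λ P θ * eval d Λ h θ / eval d Λ (Q + t • h) θ) (dm d) :=
    integrable_dm (((continuous_eval P).mul (continuous_eval h)).div (continuous_eval _)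
      fun θ => (hQt θ).ne')
  have key : ∫ θ, (eval d Λ P θ * Real.log (eval d Λ Q θ) +
        t * (eval d Λ P θ * eval d Λ h θ / eval d Λ (Q + t • h) θ)) ∂(dm d) ≤
      ∫ θ, eval d Λ P θ * Real.log (eval d Λ (Q + t • h) θ) ∂(dm d) := by
    refine integral_mono (i1.add (i3.const_mul t)) i2 fun θ => ?_
    have hlog := Real.one_sub_inv_le_log_of_pos (div_pos (hQt θ) (hQ θ))
    rw [Real.log_div (hQt θ).ne' (hQ θ).ne', inv_div] at hlog
    have e : 1 - eval d Λ Q θ / eval d Λ (Q + t • h) θ =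
        t * eval d Λ h θ / eval d Λ (Q + t • h) θ := by
      have := (hQt θ).ne'
      field_simp
      rw [eval_add, eval_smul]
      ring
    rw [e] at hlog
    have := mul_le_mul_of_nonneg_left hlog (hP θ)
    simp only
    have e2 : eval d Λ P θ * (t * eval d Λ h θ / eval d Λ (Q + t • h) θ) =
      t * (eval d Λ P θ * eval d Λ h θ / eval d Λ (Q + t • h) θ) := by ring
    rw [e2] at this
    linarith
  rw [integral_add i1 (i3.const_mul t), integral_const_mul] at key
  simp only [J, pair_add, pair_smul]
  linarith

/-- On the nonnegative cone, `⟨c, ·⟩` dominates a multiple of the ℓ¹ norm. -/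
lemma exists_coeffNorm_le_pair {c : (Fin d → ℤ) → ℂ} (h0 : (0 : Fin d → ℤ) ∈ Λ)
    (hc : c ∈ Cplus d Λ) :
    ∃ δ > 0, ∀ q ∈ Pbar d Λ, δ * coeffNorm d Λ q ≤ pair d Λ c q := by
  set K : Set ((Fin d → ℤ) → ℂ) :=
    {q | IsCoeff d Λ q} ∩ {q | ∀ θ ∈ Td d, 0 ≤ eval d Λ q θ} ∩ {q | coeffNorm d Λ q = 1} with hK
  have hclosed : IsClosed K := by
    refine (isClosed_isCoeff.inter ?_).inter (isClosed_eq continuous_coeffNorm continuous_const)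
    simp only [ofPred_forall]
    exact isClosed_iInter fun θ => isClosed_iInter fun _ =>
      isClosed_le continuous_const (continuous_eval_left θ)
  have hcomp : IsCompact K := isCompact_of_coeffNorm_le hclosed 1 fun q hq => ⟨hq.1.1, hq.2.le⟩
  obtain ⟨q₀, hq₀, hmin⟩ := hcomp.exists_isMinOn
    ⟨oneCoeff d, ⟨isCoeff_oneCoeff h0, fun θ _ => by simp [eval_oneCoeff h0]⟩,
      coeffNorm_oneCoeff h0⟩ (continuous_pair (Λ := Λ) c).continuousOn
  have hq₀' : q₀ ≠ 0 := by
    rintro rfl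
    have : coeffNorm d Λ 0 = 1 := hq₀.2
    simp [coeffNorm] at this
  refine ⟨pair d Λ c q₀, hc.2 q₀ hq₀.1 hq₀', fun q hq => ?_⟩
  rcases (coeffNorm_nonneg (Λ := Λ) q).eq_or_lt with hS | hS
  · rw [← hS, mul_zero]
    by_cases hq0 : q = 0
    · simp [hq0, pair]
    · exact (hc.2 q hq hq0).le
  · have hmem : (coeffNorm d Λ q)⁻¹ • q ∈ K := by
      refine ⟨⟨hq.1.smul _, fun θ hθ => ?_⟩, ?_⟩
      · rw [eval_smul]
        exact mul_nonneg (inv_nonneg.mpr hS.le) (hq.2 θ hθ)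
      · change coeffNorm d Λ _ = 1
        rw [coeffNorm_smul, abs_of_pos (inv_pos.mpr hS), inv_mul_cancel₀ hS.ne']
    have := hmin hmem
    simp only [mem_ofPred_eq, pair_smul] at this
    rwa [inv_mul_eq_div, le_div_iff₀ hS] at this

lemma J_oneCoeff (h0 : (0 : Fin d → ℤ) ∈ Λ) (c P : (Fin d → ℤ) → ℂ) :
    J d Λ c P (oneCoeff d) = pair d Λ c (oneCoeff d) := by
  simp [J, eval_oneCoeff h0]

/-- The dual functional is coercive on the positive cone. -/
lemma exists_J_oneCoeff_lt {c P : (Fin d → ℤ) → ℂ} (h0 : (0 : Fin d → ℤ) ∈ Λ)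
    (hc : c ∈ Cplus d Λ) (hP : P ∈ Pplus d Λ) :
    ∃ R, 1 ≤ R ∧ ∀ q ∈ Pplus d Λ, R ≤ coeffNorm d Λ q →
      J d Λ c P (oneCoeff d) < J d Λ c P q := by
  obtain ⟨δ, hδ, hpair⟩ := exists_coeffNorm_le_pair h0 hc
  set A := ∫ θ, eval d Λ P θ ∂(dm d) with hA
  have hA0 : 0 ≤ A := integral_nonneg fun θ => (eval_pos_of_mem_Pplus hP θ).le
  have hε : 0 < δ / (2 * (A + 1)) := by positivity
  obtain ⟨R, hR⟩ := Filter.eventually_atTop.mp (Real.isLittleO_log_id_atTop.bound hε)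
  refine ⟨max (max R 1) (2 * pair d Λ c (oneCoeff d) / δ + 1),
    (le_max_right _ _).trans (le_max_left _ _), fun q hq hqR => ?_⟩
  rw [J_oneCoeff h0]
  set S := coeffNorm d Λ q with hS
  have hSR : R ≤ S := (le_max_left _ _).trans ((le_max_left _ _).trans hqR)
  have hS1 : 1 ≤ S := (le_max_right _ _).trans ((le_max_left _ _).trans hqR)
  have hS2 : 2 * pair d Λ c (oneCoeff d) / δ + 1 ≤ S := (le_max_right _ _).trans hqR
  have hS0 : 0 < S := by linarith
  have hlog : A * Real.log S ≤ δ / 2 * S := by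
    have h := hR S hSR
    rw [Real.norm_eq_abs, id, Real.norm_eq_abs, abs_of_pos hS0,
      abs_of_nonneg (Real.log_nonneg hS1)] at h
    have h' := mul_le_mul_of_nonneg_left h hA0
    have e : A * (δ / (2 * (A + 1)) * S) = A / (A + 1) * (δ / 2 * S) := by field_simp
    have : A / (A + 1) ≤ 1 := by rw [div_le_one (by positivity)]; linarith
    calc A * Real.log S ≤ A / (A + 1) * (δ / 2 * S) := e ▸ h'
      _ ≤ 1 * (δ / 2 * S) := by gcongr
      _ = _ := one_mul _
  have hint : ∫ θ, eval d Λ P θ * Real.log (eval d Λ q θ) ∂(dm d) ≤ A * Real.log S := by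
    rw [hA, ← integral_mul_const]
    refine integral_mono (integrable_dm (continuous_mul_log_eval P (eval_pos_of_mem_Pplus hq)))
      ((integrable_dm (continuous_eval P)).mul_const _) fun θ => ?_
    exact mul_le_mul_of_nonneg_left
      (Real.log_le_log (eval_pos_of_mem_Pplus hq θ) ((le_abs_self _).trans (abs_eval_le q θ)))
      (eval_pos_of_mem_Pplus hP θ).le
  have hp := hpair q ⟨hq.1, fun θ hθ => (hq.2 θ hθ).le⟩
  have h3 : 2 * pair d Λ c (oneCoeff d) < S * δ := by
    rw [← div_lt_iff₀ hδ]; linarith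
  rw [J]
  linarith

lemma abs_dotP_le {r : ℝ} (k : Fin d → ℤ) {x : Fin d → ℝ} (hx : ∀ j, |x j| ≤ r) :
    |dotP d k x| ≤ (∑ j, |(k j : ℝ)|) * r := by
  rw [dotP, Finset.sum_mul]
  refine (Finset.abs_sum_le_sum_abs _ _).trans (Finset.sum_le_sum fun j _ => ?_)
  rw [abs_mul]
  gcongr
  exact hx j

/-- Quadratic growth of a trigonometric polynomial near a global minimum. -/
lemma eval_le_of_near_min {L r : ℝ} (hL : ∀ k ∈ Λ, ∑ j, |(k j : ℝ)| ≤ L) (hr : 0 ≤ r)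
    (q : (Fin d → ℤ) → ℂ) {θ₀ θ : Fin d → ℝ} (hmin : ∀ θ', eval d Λ q θ₀ ≤ eval d Λ q θ')
    (hθ : ∀ j, |(θ - θ₀) j| ≤ r) :
    eval d Λ q θ ≤ eval d Λ q θ₀ + coeffNorm d Λ q * (L * r) ^ 2 := by
  have hreflect := hmin (θ₀ - (θ - θ₀))
  have hdiff : eval d Λ q θ + eval d Λ q (θ₀ - (θ - θ₀)) - 2 * eval d Λ q θ₀ =
      (∑ k ∈ Λ, q k * (Complex.exp (-(dotP d k θ₀ : ℂ) * Complex.I) *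
        ((2 * Real.cos (dotP d k (θ - θ₀)) - 2 : ℝ) : ℂ))).re := by
    have e2 : 2 * eval d Λ q θ₀ =
        (∑ k ∈ Λ, 2 * (q k * Complex.exp (-(dotP d k θ₀ : ℂ) * Complex.I))).re := by
      rw [← Finset.mul_sum, eval, Complex.mul_re]
      simp
    rw [e2, eval, eval, ← Complex.add_re, ← Complex.sub_re, ← Finset.sum_add_distrib,
      ← Finset.sum_sub_distrib]
    congr 1
    refine Finset.sum_congr rfl fun k _ => ?_
    have h1 : dotP d k θ = dotP d k θ₀ + dotP d k (θ - θ₀) := by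
      simp only [dotP, ← Finset.sum_add_distrib, Pi.sub_apply]
      exact Finset.sum_congr rfl fun j _ => by ring
    have h2 : dotP d k (θ₀ - (θ - θ₀)) = dotP d k θ₀ - dotP d k (θ - θ₀) := by
      simp only [dotP, ← Finset.sum_sub_distrib, Pi.sub_apply]
      exact Finset.sum_congr rfl fun j _ => by ring
    rw [h1, h2]
    push_cast
    rw [Complex.two_cos]
    have e3 : Complex.exp (-((dotP d k θ₀ : ℂ) + dotP d k (θ - θ₀)) * Complex.I) =
        Complex.exp (-(dotP d k θ₀ : ℂ) * Complex.I) *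
          Complex.exp (-(dotP d k (θ - θ₀) : ℂ) * Complex.I) := by
      rw [← Complex.exp_add]; ring_nf
    have e4 : Complex.exp (-((dotP d k θ₀ : ℂ) - dotP d k (θ - θ₀)) * Complex.I) =
        Complex.exp (-(dotP d k θ₀ : ℂ) * Complex.I) *
          Complex.exp ((dotP d k (θ - θ₀) : ℂ) * Complex.I) := by
      rw [← Complex.exp_add]; ring_nf
    rw [e3, e4]
    ring
  have hbound : eval d Λ q θ + eval d Λ q (θ₀ - (θ - θ₀)) - 2 * eval d Λ q θ₀ ≤
      coeffNorm d Λ q * (L * r) ^ 2 := by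
    rw [hdiff, coeffNorm, Finset.sum_mul]
    refine (Complex.re_le_norm _).trans ((norm_sum_le _ _).trans (Finset.sum_le_sum fun k hk => ?_))
    rw [norm_mul, norm_mul, norm_exp_dotP, one_mul, Complex.norm_real, Real.norm_eq_abs]
    refine mul_le_mul_of_nonneg_left ?_ (norm_nonneg _)
    have hd : |dotP d k (θ - θ₀)| ≤ L * r :=
      (abs_dotP_le k hθ).trans (mul_le_mul_of_nonneg_right (hL k hk) hr)
    have hsq : dotP d k (θ - θ₀) ^ 2 ≤ (L * r) ^ 2 :=
      sq_le_sq' (abs_le.mp hd).1 (abs_le.mp hd).2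
    have hcos := Real.one_sub_sq_div_two_le_cos (x := dotP d k (θ - θ₀))
    rw [abs_of_nonpos (by linarith [Real.cos_le_one (dotP d k (θ - θ₀))])]
    linarith
  linarith

/-- Small cubes centred in the closed box have mass at least a constant times `r ^ 2` on the torus. -/
lemma le_dm_cube (hd2 : d ≤ 2) {r : ℝ} (hr0 : 0 ≤ r) (hr1 : r ≤ 1) {θ₀ : Fin d → ℝ}
    (hθ₀ : θ₀ ∈ Set.univ.pi fun _ : Fin d => Icc (-Real.pi) Real.pi) :
    ENNReal.ofReal (((2 * Real.pi) ^ d)⁻¹ * r ^ 2) ≤ dm d {θ | ∀ j, |(θ - θ₀) j| ≤ r} := by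
  have hπ : 0 < (2 * Real.pi) ^ d := pow_pos Real.two_pi_pos d
  have hpi := Real.pi_gt_three
  set a : Fin d → ℝ := fun j => if θ₀ j ≤ 0 then θ₀ j else θ₀ j - r with ha
  have hsub : (Set.univ.pi fun j => Ioc (a j) (a j + r)) ⊆
      {θ | ∀ j, |(θ - θ₀) j| ≤ r} ∩ Td d := by
    intro θ hθ
    have h : ∀ j, |(θ - θ₀) j| ≤ r ∧ θ j ∈ Ioc (-Real.pi) Real.pi := fun j => by
      obtain ⟨h1, h2⟩ := hθ j (mem_univ j)
      obtain ⟨h3, h4⟩ := hθ₀ j (mem_univ j)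
      simp only [ha] at h1 h2
      rw [Pi.sub_apply, abs_le]
      split_ifs at h1 h2 with hs
      · exact ⟨⟨by linarith, by linarith⟩, by linarith, by linarith⟩
      · push Not at hs
        exact ⟨⟨by linarith, by linarith⟩, by linarith, by linarith⟩
    exact ⟨fun j => (h j).1, fun j _ => (h j).2⟩
  have hvol : volume (Set.univ.pi fun j => Ioc (a j) (a j + r)) = ENNReal.ofReal (r ^ d) := by
    rw [volume_pi_pi]
    simp [ENNReal.ofReal_pow hr0]
  rw [dm, Measure.smul_apply, smul_eq_mul, ENNReal.ofReal_mul (inv_nonneg.mpr hπ.le),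
    ENNReal.ofReal_inv_of_pos hπ]
  gcongr
  calc ENNReal.ofReal (r ^ 2) ≤ ENNReal.ofReal (r ^ d) :=
        ENNReal.ofReal_le_ofReal (pow_le_pow_of_le_one hr0 hr1 hd2)
    _ ≤ volume ({θ | ∀ j, |(θ - θ₀) j| ≤ r} ∩ Td d) := hvol ▸ measure_mono hsub
    _ ≤ _ := Measure.le_restrict_apply _ _

/-- In dimension at most two, a bound on `∫ 1/Q` bounds a positive polynomial `Q` away from zero,
uniformly on bounded sets of coefficients. -/
lemma exists_le_eval_of_integral_inv_le (hd2 : d ≤ 2) (Λ : Finset (Fin d → ℤ)) {R M : ℝ}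
    (hR : 1 ≤ R) (hM : 0 ≤ M) :
    ∃ η > 0, ∀ q ∈ Pplus d Λ, coeffNorm d Λ q ≤ R →
      ∫ θ, (eval d Λ q θ)⁻¹ ∂(dm d) ≤ M → ∀ θ, η ≤ eval d Λ q θ := by
  set L : ℝ := 1 + ∑ k ∈ Λ, ∑ j, |(k j : ℝ)| with hLdef
  have hL : ∀ k ∈ Λ, ∑ j, |(k j : ℝ)| ≤ L := fun k hk => by
    have := Finset.single_le_sum (f := fun k : Fin d → ℤ => ∑ j, |(k j : ℝ)|)
      (fun k _ => Finset.sum_nonneg fun j _ => abs_nonneg _) hk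
    linarith
  have hL1 : 1 ≤ L := le_add_of_nonneg_right
    (Finset.sum_nonneg fun k _ => Finset.sum_nonneg fun j _ => abs_nonneg _)
  set C := R * L ^ 2 with hC
  have hC1 : 1 ≤ C := one_le_mul_of_one_le_of_one_le hR (one_le_pow₀ hL1)
  have hC0 : 0 < C := by linarith
  set κ := ((2 * Real.pi) ^ d)⁻¹ with hκ
  have hκ0 : 0 < κ := inv_pos.mpr (pow_pos Real.two_pi_pos d)
  refine ⟨C * Real.exp (-(2 * C * M / κ)), by positivity, fun q hq hqR hqM θ => ?_⟩
  obtain ⟨θ₀, hθ₀, hmin⟩ := exists_eval_min (Λ := Λ) q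
  refine le_trans ?_ (hmin θ)
  have hm := eval_pos_of_mem_Pplus hq θ₀
  set m := eval d Λ q θ₀ with hmdef
  rcases le_or_gt C m with hCm | hCm
  · exact (mul_le_of_le_one_right hC0.le
      (Real.exp_le_one_iff.mpr (neg_nonpos.mpr (by positivity)))).trans hCm
  have hinvcont : Continuous fun θ => (eval d Λ q θ)⁻¹ :=
    (continuous_eval q).inv₀ fun θ => (eval_pos_of_mem_Pplus hq θ).ne'
  have hinvpos : ∀ θ, 0 ≤ (eval d Λ q θ)⁻¹ := fun θ =>
    (inv_pos.mpr (eval_pos_of_mem_Pplus hq θ)).le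
  have hab : 1 / (2 * C) ≤ 1 / (2 * m) := one_div_le_one_div_of_le (by positivity) (by linarith)
  have hlevel : ∀ t ∈ Ioc (1 / (2 * C)) (1 / (2 * m)),
      ENNReal.ofReal (κ / (2 * C) * t⁻¹) ≤ dm d {θ | t ≤ (eval d Λ q θ)⁻¹} := by
    intro t ⟨ht1, ht2⟩
    have ht0 : 0 < t := lt_trans (by positivity) ht1
    set r := Real.sqrt (1 / (2 * C * t)) with hr
    have hrsq : r ^ 2 = 1 / (2 * C * t) := Real.sq_sqrt (by positivity)
    have hr1 : r ≤ 1 := by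
      refine Real.sqrt_le_one.mpr ?_
      rw [div_le_one (by positivity)]
      rw [div_lt_iff₀ (by positivity)] at ht1
      linarith
    have e : κ / (2 * C) * t⁻¹ = κ * r ^ 2 := by rw [hrsq]; field_simp
    rw [e]
    refine (le_dm_cube hd2 (Real.sqrt_nonneg _) hr1 hθ₀).trans (measure_mono fun θ' hθ' => ?_)
    have hle := eval_le_of_near_min hL (Real.sqrt_nonneg _) q hmin hθ'
    rw [← hr, mul_pow] at hle
    have hb : coeffNorm d Λ q * (L ^ 2 * r ^ 2) ≤ C * r ^ 2 := by
      rw [hC, mul_assoc R]; gcongr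
    have hb2 : C * r ^ 2 = 1 / (2 * t) := by rw [hrsq]; field_simp
    have hb3 : m ≤ 1 / (2 * t) := by
      rw [le_div_iff₀ (by positivity)] at ht2 ⊢
      linarith
    have hb4 : 1 / (2 * t) + 1 / (2 * t) = t⁻¹ := by field_simp; norm_num
    exact (le_inv_comm₀ ht0 (eval_pos_of_mem_Pplus hq θ')).mpr (by linarith)
  have hlayer : ENNReal.ofReal (κ / (2 * C) * Real.log (C / m)) ≤
      ENNReal.ofReal (∫ θ, (eval d Λ q θ)⁻¹ ∂(dm d)) := by
    have hii : IntegrableOn (fun t : ℝ => κ / (2 * C) * t⁻¹) (Ioc (1 / (2 * C)) (1 / (2 * m))) := by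
      rw [← intervalIntegrable_iff_integrableOn_Ioc_of_le hab]
      refine (intervalIntegral.intervalIntegrable_inv (fun x hx => ?_) continuousOn_id).const_mul _
      rw [uIcc_of_le hab] at hx
      exact (lt_of_lt_of_le (by positivity) hx.1).ne'
    have hval : ∫ t in Ioc (1 / (2 * C)) (1 / (2 * m)), κ / (2 * C) * t⁻¹ =
        κ / (2 * C) * Real.log (C / m) := by
      rw [integral_const_mul, ← intervalIntegral.integral_of_le hab,
        integral_inv_of_pos (by positivity) (by positivity)]
      congr 2
      field_simp
    rw [← hval, ofReal_integral_eq_lintegral_ofReal hii, ofReal_integral_eq_lintegral_ofReal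
      (integrable_dm hinvcont) (ae_of_all _ hinvpos), lintegral_eq_lintegral_meas_le _
      (ae_of_all _ hinvpos) hinvcont.aemeasurable]
    · refine (setLIntegral_mono' measurableSet_Ioc hlevel).trans (lintegral_mono_set ?_)
      exact fun t ht => lt_trans (by positivity) ht.1
    · refine (ae_restrict_iff' measurableSet_Ioc).mpr (ae_of_all _ fun t ht => ?_)
      have ht0 : 0 < t := lt_trans (by positivity) ht.1
      simp only [Pi.zero_apply]
      positivity
  have hlog : Real.log (C / m) ≤ 2 * C * M / κ := by
    have := ((ENNReal.ofReal_le_ofReal_iff (integral_nonneg hinvpos)).mp hlayer).trans hqM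
    rw [le_div_iff₀ hκ0]
    rw [div_mul_eq_mul_div, div_le_iff₀ (by positivity)] at this
    linarith
  rw [Real.log_le_iff_le_exp (by positivity), div_le_iff₀ hm] at hlog
  rw [Real.exp_neg, ← div_eq_mul_inv, div_le_iff₀ (Real.exp_pos _)]
  linarith

lemma continuousOn_J (c P : (Fin d → ℤ) → ℂ) {ε R : ℝ} (hε : 0 < ε) :
    ContinuousOn (J d Λ c P) {q | (∀ θ, ε ≤ eval d Λ q θ) ∧ coeffNorm d Λ q ≤ R} := by
  refine (continuous_pair c).continuousOn.sub ?_
  refine continuousOn_of_dominated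
    (bound := fun _ => coeffNorm d Λ P * (|Real.log ε| + |Real.log R|))
    (fun q hq => ?_) (fun q hq => ae_of_all _ fun θ => ?_) (integrable_const _)
    (ae_of_all _ fun θ => ?_)
  · exact (continuous_mul_log_eval P fun θ => hε.trans_le (hq.1 θ)).aestronglyMeasurable
  · rw [norm_mul, Real.norm_eq_abs, Real.norm_eq_abs]
    refine mul_le_mul (abs_eval_le P θ) ?_ (abs_nonneg _) (coeffNorm_nonneg P)
    have h1 := Real.log_le_log hε (hq.1 θ)
    have h2 := Real.log_le_log (hε.trans_le (hq.1 θ))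
      ((le_abs_self _).trans ((abs_eval_le q θ).trans hq.2))
    rw [abs_le]
    constructor
    · linarith [neg_abs_le (Real.log ε), abs_nonneg (Real.log R)]
    · linarith [le_abs_self (Real.log R), abs_nonneg (Real.log ε)]
  · exact continuousOn_const.mul ((continuous_eval_left θ).continuousOn.log
      fun q hq => (hε.trans_le (hq.1 θ)).ne')

theorem exists_min_J (hd2 : d ≤ 2) (hΛ : ∀ k ∈ Λ, -k ∈ Λ) {c P : (Fin d → ℤ) → ℂ}
    (h0 : (0 : Fin d → ℤ) ∈ Λ) (hc : c ∈ Cplus d Λ) (hP : P ∈ Pplus d Λ) :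
    ∃ Q ∈ Pplus d Λ, ∀ Q' ∈ Pplus d Λ, J d Λ c P Q ≤ J d Λ c P Q' := by
  obtain ⟨R, hR1, hR⟩ := exists_J_oneCoeff_lt h0 hc hP
  obtain ⟨b, hb, hbP⟩ := exists_pos_le_eval_of_mem_Pplus hP
  have h1 := isCoeff_oneCoeff h0
  have hc1 : 0 ≤ pair d Λ c (oneCoeff d) := by
    refine (hc.2 _ ⟨h1, fun θ _ => by simp [eval_oneCoeff h0]⟩ fun h => ?_).le
    have := congrFun h 0
    simp [oneCoeff] at this
  obtain ⟨η, hη, hηle⟩ := exists_le_eval_of_integral_inv_le hd2 Λ hR1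
    (M := 2 * pair d Λ c (oneCoeff d) / b) (by positivity)
  set ε := min (η / 2) 1 with hεdef
  have hε : 0 < ε := by positivity
  have hεη : 2 * ε ≤ η := by linarith [min_le_left (η / 2) 1]
  set K : Set ((Fin d → ℤ) → ℂ) := {q | IsCoeff d Λ q} ∩
    {q | (∀ θ, ε ≤ eval d Λ q θ) ∧ coeffNorm d Λ q ≤ R} with hK
  have hclosed : IsClosed K := by
    refine isClosed_isCoeff.inter ?_
    simp only [ofPred_and, ofPred_forall]
    exact (isClosed_iInter fun θ => isClosed_le continuous_const (continuous_eval_left θ)).inter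
      (isClosed_le continuous_coeffNorm continuous_const)
  have hone : oneCoeff d ∈ K :=
    ⟨h1, fun θ => by rw [eval_oneCoeff h0]; exact min_le_right _ _,
      by rwa [coeffNorm_oneCoeff h0]⟩
  obtain ⟨Q, hQK, hQmin⟩ :=
    (isCompact_of_coeffNorm_le hclosed R fun q hq => ⟨hq.1, hq.2.2⟩).exists_isMinOn ⟨_, hone⟩
      ((continuousOn_J c P hε).mono inter_subset_right)
  have hQpos : ∀ θ, 0 < eval d Λ Q θ := fun θ => hε.trans_le (hQK.2.1 θ)
  have hQP : Q ∈ Pplus d Λ := ⟨hQK.1, fun θ _ => hQpos θ⟩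
  have hmin : ∀ q, IsCoeff d Λ q → (∀ θ, ε ≤ eval d Λ q θ) → J d Λ c P Q ≤ J d Λ c P q := by
    intro q hq hqε
    rcases le_total (coeffNorm d Λ q) R with h | h
    · exact hQmin ⟨hq, hqε, h⟩
    · exact (hQmin hone).trans (hR q ⟨hq, fun θ _ => hε.trans_le (hqε θ)⟩ h).le
  have heval : ∀ θ, eval d Λ (Q + ε • oneCoeff d) θ = eval d Λ Q θ + ε := fun θ => by
    rw [eval_add, eval_smul, eval_oneCoeff h0, mul_one]
  have hpos' : ∀ θ, 0 < eval d Λ (Q + ε • oneCoeff d) θ := fun θ => by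
    rw [heval]; linarith [hQpos θ]
  have hQη : ∀ θ, η ≤ eval d Λ Q θ := by
    refine hηle Q hQP hQK.2.2 ?_
    have hle := (hmin (Q + ε • oneCoeff d) (hQK.1.add (h1.smul ε)) fun θ => by
      rw [heval]; linarith [hQpos θ]).trans
        (J_add_smul_le (c := c) (fun θ => (eval_pos_of_mem_Pplus hP θ).le) hQpos hpos')
    have hint : ∫ θ, eval d Λ P θ * eval d Λ (oneCoeff d) θ /
        eval d Λ (Q + ε • oneCoeff d) θ ∂(dm d) ≤ pair d Λ c (oneCoeff d) :=
      sub_nonneg.mp (nonneg_of_mul_nonneg_right (by linarith) hε)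
    have hcomp : b / 2 * ∫ θ, (eval d Λ Q θ)⁻¹ ∂(dm d) ≤ ∫ θ, eval d Λ P θ *
        eval d Λ (oneCoeff d) θ / eval d Λ (Q + ε • oneCoeff d) θ ∂(dm d) := by
      rw [← integral_const_mul]
      refine integral_mono
        ((integrable_dm ((continuous_eval Q).inv₀ fun θ => (hQpos θ).ne')).const_mul _)
        (integrable_dm (((continuous_eval P).mul (continuous_eval _)).div (continuous_eval _)
          fun θ => (hpos' θ).ne')) fun θ => ?_
      simp only [heval, eval_oneCoeff h0, mul_one]
      rw [← div_eq_mul_inv, div_div]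
      exact div_le_div₀ (eval_pos_of_mem_Pplus hP θ).le (hbP θ) (by linarith [hQpos θ])
        (by linarith [hQK.2.1 θ])
    rw [le_div_iff₀ hb]
    linarith
  refine ⟨Q, hQP, fun q hq => ?_⟩
  have hmid := hmin ((1 / 2 : ℝ) • Q + (1 / 2 : ℝ) • q) ((hQK.1.smul _).add (hq.1.smul _))
    fun θ => by
      rw [eval_add, eval_smul, eval_smul]
      linarith [hQη θ, eval_pos_of_mem_Pplus hq θ]
  have hcv := (strictConvexOn_J hΛ c hP).convexOn.2 hQP hq
    (show (0 : ℝ) ≤ 1 / 2 by norm_num) (show (0 : ℝ) ≤ 1 / 2 by norm_num) (by norm_num)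
  simp only [smul_eq_mul] at hcv
  linarith

/-- First-order optimality of a minimizer of the dual functional. -/
lemma integral_le_pair_of_min {c P Q h : (Fin d → ℤ) → ℂ} (hP : P ∈ Pplus d Λ)
    (hQ : Q ∈ Pplus d Λ) (hmin : ∀ Q' ∈ Pplus d Λ, J d Λ c P Q ≤ J d Λ c P Q')
    (hh : IsCoeff d Λ h) :
    ∫ θ, eval d Λ P θ / eval d Λ Q θ * eval d Λ h θ ∂(dm d) ≤ pair d Λ c h := by
  obtain ⟨η, hη, hQη⟩ := exists_pos_le_eval_of_mem_Pplus hQ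
  have hP' := eval_pos_of_mem_Pplus hP
  have hQ' := eval_pos_of_mem_Pplus hQ
  set S := coeffNorm d Λ h with hS
  have hS0 : 0 ≤ S := coeffNorm_nonneg h
  set B := coeffNorm d Λ P * S ^ 2 / (η * (η / 2)) with hB
  have hB0 : 0 ≤ B := div_nonneg (mul_nonneg (coeffNorm_nonneg P) (sq_nonneg _)) (by positivity)
  have hsmall : ∀ t : ℝ, 0 < t → t * S ≤ η / 2 →
      ∫ θ, eval d Λ P θ / eval d Λ Q θ * eval d Λ h θ ∂(dm d) ≤ pair d Λ c h + t * B := by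
    intro t ht htS
    have heval : ∀ θ, eval d Λ (Q + t • h) θ = eval d Λ Q θ + t * eval d Λ h θ := fun θ => by
      rw [eval_add, eval_smul]
    have hge : ∀ θ, η / 2 ≤ eval d Λ (Q + t • h) θ := fun θ => by
      have h1 := mul_le_mul_of_nonneg_left ((neg_le_abs _).trans (abs_eval_le (Λ := Λ) h θ)) ht.le
      rw [heval]
      linarith [hQη θ]
    have hpos : ∀ θ, 0 < eval d Λ (Q + t • h) θ := fun θ => (half_pos hη).trans_le (hge θ)
    have hle := (hmin _ ⟨hQ.1.add (hh.smul t), fun θ _ => hpos θ⟩).trans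
      (J_add_smul_le (c := c) (fun θ => (hP' θ).le) hQ' hpos)
    have hint : ∫ θ, eval d Λ P θ * eval d Λ h θ / eval d Λ (Q + t • h) θ ∂(dm d) ≤
        pair d Λ c h := sub_nonneg.mp (nonneg_of_mul_nonneg_right (by linarith) ht)
    have i1 : Integrable (fun θ => eval d Λ P θ * eval d Λ h θ / eval d Λ (Q + t • h) θ) (dm d) :=
      integrable_dm (((continuous_eval P).mul (continuous_eval h)).div (continuous_eval _)
        fun θ => (hpos θ).ne')
    have hcomp : ∫ θ, eval d Λ P θ / eval d Λ Q θ * eval d Λ h θ ∂(dm d) ≤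
        ∫ θ, (eval d Λ P θ * eval d Λ h θ / eval d Λ (Q + t • h) θ + t * B) ∂(dm d) := by
      refine integral_mono (integrable_dm (((continuous_eval P).div (continuous_eval Q)
        fun θ => (hQ' θ).ne').mul (continuous_eval h))) (i1.add (integrable_const _)) fun θ => ?_
      have e : eval d Λ P θ / eval d Λ Q θ * eval d Λ h θ =
          eval d Λ P θ * eval d Λ h θ / eval d Λ (Q + t • h) θ +
          t * (eval d Λ P θ * eval d Λ h θ ^ 2 /
            (eval d Λ Q θ * eval d Λ (Q + t • h) θ)) := by
        have h1 := (hQ' θ).ne'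
        have h2 := (hpos θ).ne'
        field_simp
        rw [heval]
        ring
      simp only
      rw [e]
      gcongr
      refine div_le_div₀ (mul_nonneg (coeffNorm_nonneg P) (sq_nonneg _))
        (mul_le_mul ((le_abs_self _).trans (abs_eval_le P θ)) ?_ (sq_nonneg _)
          (coeffNorm_nonneg P)) (by positivity)
        (mul_le_mul (hQη θ) (hge θ) (by positivity) (hQ' θ).le)
      rw [← sq_abs]
      exact pow_le_pow_left₀ (abs_nonneg _) (abs_eval_le h θ) 2
    rw [integral_add i1 (integrable_const _), integral_const] at hcomp
    simp only [probReal_univ, one_smul] at hcomp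
    linarith
  refine le_of_forall_pos_le_add fun ε hε => ?_
  set t := min (η / 2 / (S + 1)) (ε / (B + 1)) with ht
  have ht0 : 0 < t := by positivity
  have h1 : t * (S + 1) ≤ η / 2 := (le_div_iff₀ (by positivity)).mp (min_le_left _ _)
  have h2 : t * (B + 1) ≤ ε := (le_div_iff₀ (by positivity)).mp (min_le_right _ _)
  have := hsmall t ht0 (by linarith)
  linarith

theorem matches_of_min (hΛ : ∀ k ∈ Λ, -k ∈ Λ) {c P Q : (Fin d → ℤ) → ℂ} (hc : IsCoeff d Λ c)
    (hP : P ∈ Pplus d Λ) (hQ : Q ∈ Pplus d Λ)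
    (hmin : ∀ Q' ∈ Pplus d Λ, J d Λ c P Q ≤ J d Λ c P Q') :
    Matches d Λ c fun θ => eval d Λ P θ / eval d Λ Q θ := by
  classical
  set Φ : (Fin d → ℝ) → ℝ := fun θ => eval d Λ P θ / eval d Λ Q θ with hΦ
  have hΦc : Continuous Φ := (continuous_eval P).div (continuous_eval Q)
    fun θ => (eval_pos_of_mem_Pplus hQ θ).ne'
  set c' : (Fin d → ℤ) → ℂ := fun k => if k ∈ Λ then
    ∫ θ, Complex.exp ((dotP d k θ : ℂ) * Complex.I) * (Φ θ : ℂ) ∂(dm d) else 0 with hc'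
  have hc'Λ : ∀ k ∈ Λ, c' k =
      ∫ θ, Complex.exp ((dotP d k θ : ℂ) * Complex.I) * (Φ θ : ℂ) ∂(dm d) :=
    fun k hk => if_pos hk
  have hc'coeff : IsCoeff d Λ c' := by
    refine ⟨fun k hk => if_neg hk, fun k => ?_⟩
    by_cases hk : k ∈ Λ
    · rw [hc'Λ k hk, hc'Λ _ (hΛ k hk), ← integral_conj]
      congr 1
      funext θ
      rw [map_mul, ← Complex.exp_conj, dotP_neg]
      simp
    · have hk' : -k ∉ Λ := fun h => hk (neg_neg k ▸ hΛ _ h)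
      simp [hc', hk, hk']
  set h := c' + (-1 : ℝ) • c with hh
  have hopt := integral_le_pair_of_min hP hQ hmin (hc'coeff.add (hc.smul (-1)))
  rw [← pair_moments hΦc c' h hc'Λ] at hopt
  have hnorm : pair d Λ c' h - pair d Λ c h = ∑ k ∈ Λ, ‖h k‖ ^ 2 := by
    rw [pair, pair, ← Complex.sub_re, ← Finset.sum_sub_distrib, Complex.re_sum]
    refine Finset.sum_congr rfl fun k _ => ?_
    have e : c' k - c k = h k := by simp [hh, sub_eq_add_neg]
    rw [← sub_mul, e, Complex.mul_conj, Complex.ofReal_re, Complex.normSq_eq_norm_sq]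
  have hzero : ∑ k ∈ Λ, ‖h k‖ ^ 2 = 0 :=
    le_antisymm (by linarith) (Finset.sum_nonneg fun _ _ => sq_nonneg _)
  intro k hk
  have hk0 := (Finset.sum_eq_zero_iff_of_nonneg fun _ _ => sq_nonneg _).mp hzero k hk
  have hk1 : h k = 0 := by simpa using hk0
  rw [← hc'Λ k hk]
  simp only [hh, Pi.add_apply, neg_smul, one_smul] at hk1
  exact (add_neg_eq_zero.mp hk1).symm

end

/-- for d ≤ 2, c ∈ ℭ₊ and P ∈ 𝔓₊ there is a Q ∈ 𝔓₊ such that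
dμ = (P/Q)dm matches the moments c; moreover this Q is the unique solution of the
strictly convex problem of minimizing the dual functional J_P over 𝔓₊. -/
theorem statement2 (d : ℕ) (hd1 : 1 ≤ d) (hd2 : d ≤ 2) (Λ : Finset (Fin d → ℤ))
    (h0 : (0 : Fin d → ℤ) ∈ Λ) (hΛ : ∀ k ∈ Λ, -k ∈ Λ)
    (c P : (Fin d → ℤ) → ℂ) (hc : c ∈ Cplus d Λ) (hP : P ∈ Pplus d Λ) :
    StrictConvexOn ℝ (Pplus d Λ) (J d Λ c P) ∧
    ∃ Q ∈ Pplus d Λ,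
      Matches d Λ c (fun θ => eval d Λ P θ / eval d Λ Q θ) ∧
      (∀ Q' ∈ Pplus d Λ, J d Λ c P Q ≤ J d Λ c P Q') ∧
      ∀ Q' ∈ Pplus d Λ,
        (∀ Q'' ∈ Pplus d Λ, J d Λ c P Q' ≤ J d Λ c P Q'') → Q' = Q := by
  have hconv := strictConvexOn_J hΛ c hP
  obtain ⟨Q, hQ, hmin⟩ := exists_min_J hd2 hΛ h0 hc hP
  exact ⟨hconv, Q, hQ, matches_of_min hΛ hc.1 hP hQ hmin, hmin, fun Q' hQ' hmin' =>
    hconv.eq_of_isMinOn (fun q hq => hmin' q hq) (fun q hq => hmin q hq) hQ' hQ⟩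

end RCE
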